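/- arXiv:1606.08937 — 5 statements merged into one kernel-verified Lean document; each statement's English description precedes it below -/
import Mathlib

section
/- Let p > 0 and 0 < γ < 1. Then S_{0,p}(γ) = 2√p ∑_{k≥1} ( K_1(2√(p(k + iγ))) / (k + iγ)^{1/2} + K_1(2√(p(k − iγ))) / (k − iγ)^{1/2} ), where all complex square roots are principal and the right-hand side is a real number (the two summands are complex conjugates). -/
open Real MeasureTheory

/-- Bessel function of the first kind of integer order, via Bessel's integral. -/
noncomputable def besselJ (m : ℤ) (x : ℝ) : ℝ :=
  (1 / Real.pi) * ∫ θ in (0:ℝ)..Real.pi, Real.cos ((m : ℝ) * θ - x * Real.sin θ)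

/-- Modified Bessel function of the second kind (real argument). -/
noncomputable def besselK (ν x : ℝ) : ℝ :=
  ∫ t in Set.Ioi (0:ℝ), Real.exp (-x * Real.cosh t) * Real.cosh (ν * t)

/-- Modified Bessel function of the second kind (complex argument). -/
noncomputable def besselKC (ν : ℝ) (z : ℂ) : ℂ :=
  ∫ t in Set.Ioi (0:ℝ), Complex.exp (-z * (Real.cosh t : ℂ)) * (Real.cosh (ν * t) : ℂ)

/-- The p-extended Riemann zeta function. -/
noncomputable def zetaP (p α : ℝ) : ℝ :=
  (1 / Real.Gamma α) *
    ∫ t in Set.Ioi (0:ℝ), t ^ (α - 1) * Real.exp (-p / t) / (Real.exp t - 1)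

/-- The p-extended Mathieu series. -/
noncomputable def mathieuS (μ p r : ℝ) : ℝ :=
  2 * ∑' n : ℕ, (-1 : ℝ) ^ n *
      (Real.Gamma (μ + n + 1) / (n.factorial * Real.Gamma (μ + 1))) *
      zetaP p (2 * μ + 2 * n + 1) * r ^ (2 * n)

/-- A Laplace-type integral with nonnegative weight `w` is holomorphic on the right half-plane as
soon as it converges absolutely at every positive real. -/
lemma differentiableOn_setIntegral_cexp_neg_mul {g w : ℝ → ℝ} (hw : Measurable w) (hw0 : ∀ t, 0 ≤ w t)
    (hint : ∀ x > 0, IntegrableOn (fun t => Real.exp (-x * g t) * w t) (Set.Ioi 0)) :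
    DifferentiableOn ℂ (fun z : ℂ => ∫ t in Set.Ioi (0:ℝ), Complex.exp (-z * (g t : ℂ)) * (w t : ℂ))
      {z : ℂ | 0 < z.re} := by
  let μ : Measure ℝ := (volume.restrict (Set.Ioi 0)).withDensity fun t => ((w t).toNNReal : ENNReal)
  let X : ℝ → ℝ := fun t => -g t
  have hsub : Set.Ioi (0:ℝ) ⊆ ProbabilityTheory.integrableExpSet X μ := by
    intro x hx
    change Integrable _ _
    rw [integrable_withDensity_iff_integrable_smul hw.real_toNNReal]
    refine (hint x hx).congr (Filter.Eventually.of_forall fun t => ?_)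
    simp [X, NNReal.smul_def, hw0 t, mul_comm]
  have hint' : Set.Ioi (0:ℝ) ⊆ interior (ProbabilityTheory.integrableExpSet X μ) :=
    interior_maximal hsub isOpen_Ioi
  refine (ProbabilityTheory.differentiableOn_complexMGF (X := X) (μ := μ) |>.mono
    fun z hz => hint' hz).congr fun z _ => ?_
  rw [ProbabilityTheory.complexMGF, integral_withDensity_eq_integral_smul hw.real_toNNReal]
  refine integral_congr_ae (Filter.Eventually.of_forall fun t => ?_)
  simp [X, NNReal.smul_def, hw0 t, mul_comm]

lemma exp_neg_div_le_one {p t : ℝ} (hp : 0 < p) (ht : 0 < t) : Real.exp (-p / t) ≤ 1 := by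
  rw [Real.exp_le_one_iff]
  exact div_nonpos_of_nonpos_of_nonneg (by linarith) ht.le

lemma integrableOn_exp_neg_mul_mul_exp_neg_div {p x : ℝ} (hp : 0 < p) (hx : 0 < x) :
    IntegrableOn (fun t => Real.exp (-x * t) * Real.exp (-p / t)) (Set.Ioi 0) := by
  refine Integrable.mono' (exp_neg_integrableOn_Ioi 0 hx) (by fun_prop) ?_
  refine (ae_restrict_iff' measurableSet_Ioi).2 (Filter.Eventually.of_forall fun t ht => ?_)
  rw [Real.norm_of_nonneg (by positivity)]
  exact mul_le_of_le_one_right (by positivity) (exp_neg_div_le_one hp ht)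

lemma image_const_mul_exp_univ {c : ℝ} (hc : 0 < c) :
    (fun u => c * Real.exp u) '' Set.univ = Set.Ioi 0 := by
  ext y
  simp only [Set.image_univ, Set.mem_range, Set.mem_Ioi]
  refine ⟨?_, fun hy => ⟨Real.log (y / c), ?_⟩⟩
  · rintro ⟨u, rfl⟩
    positivity
  · rw [Real.exp_log (by positivity)]
    field_simp

lemma exp_comp_const_mul_exp {p x : ℝ} (hp : 0 < p) (hx : 0 < x) (u : ℝ) :
    Real.exp (-x * (√(p / x) * Real.exp u)) * Real.exp (-p / (√(p / x) * Real.exp u)) =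
      Real.exp (-(2 * √(p * x)) * Real.cosh u) := by
  have h1 : x * √(p / x) = √(p * x) := by
    rw [Real.sqrt_div hp.le, Real.sqrt_mul hp.le]
    have := Real.mul_self_sqrt hx.le
    rw [← mul_div_assoc, div_eq_iff (Real.sqrt_pos.2 hx).ne']
    linear_combination -√p * this
  have h2 : p / √(p / x) = √(p * x) := by
    rw [Real.sqrt_div hp.le, Real.sqrt_mul hp.le]
    have := Real.mul_self_sqrt hp.le
    field_simp
    linear_combination -this
  rw [← Real.exp_add, Real.cosh_eq, Real.exp_neg]
  congr 1
  rw [neg_div, ← div_div, h2, ← mul_assoc, neg_mul, h1]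
  field_simp
  ring

lemma integrable_exp_mul_exp_neg_mul_cosh {s : ℝ} (hs : 0 < s) :
    Integrable (fun u => Real.exp u * Real.exp (-s * Real.cosh u)) := by
  have h := (integrableOn_image_iff_integrableOn_abs_deriv_smul (f := fun u => 1 * Real.exp u)
    (f' := fun u => 1 * Real.exp u) MeasurableSet.univ
    (fun u _ => ((Real.hasDerivAt_exp u).const_mul 1).hasDerivWithinAt)
    (fun a _ b _ hab => by simpa using hab)
    (fun t => Real.exp (-(s / 2) * t) * Real.exp (-(s / 2) / t))).1
    (by
      rw [image_const_mul_exp_univ one_pos]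
      exact integrableOn_exp_neg_mul_mul_exp_neg_div (by positivity) (by positivity))
  rw [integrableOn_univ] at h
  refine h.congr (Filter.Eventually.of_forall fun u => ?_)
  have := exp_comp_const_mul_exp (half_pos hs) (half_pos hs) u
  rw [div_self (half_pos hs).ne', Real.sqrt_one, Real.sqrt_mul_self (half_pos hs).le] at this
  rw [mul_div_cancel₀ s two_ne_zero] at this
  simp only [smul_eq_mul, this]
  simp

lemma integrable_exp_neg_mul_exp_neg_mul_cosh {s : ℝ} (hs : 0 < s) :
    Integrable (fun u => Real.exp (-u) * Real.exp (-s * Real.cosh u)) := by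
  simpa using (integrable_exp_mul_exp_neg_mul_cosh hs).comp_neg

lemma integrable_exp_neg_mul_cosh_mul_cosh {s : ℝ} (hs : 0 < s) :
    Integrable (fun u => Real.exp (-s * Real.cosh u) * Real.cosh u) := by
  refine (((integrable_exp_mul_exp_neg_mul_cosh hs).add
    (integrable_exp_neg_mul_exp_neg_mul_cosh hs)).div_const 2).congr
    (Filter.Eventually.of_forall fun u => ?_)
  simp only [Pi.add_apply]
  linear_combination -Real.exp (-s * Real.cosh u) * Real.cosh_eq u

lemma integral_exp_mul_exp_neg_mul_cosh {s : ℝ} (hs : 0 < s) :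
    ∫ u, Real.exp u * Real.exp (-s * Real.cosh u) = 2 * besselK 1 s := by
  have hneg : ∫ u, Real.exp (-u) * Real.exp (-s * Real.cosh u) =
      ∫ u, Real.exp u * Real.exp (-s * Real.cosh u) := by
    simpa using integral_neg_eq_self (fun u => Real.exp u * Real.exp (-s * Real.cosh u)) volume
  have hadd := integral_add (integrable_exp_mul_exp_neg_mul_cosh hs)
    (integrable_exp_neg_mul_exp_neg_mul_cosh hs)
  have hcosh : ∀ u, Real.exp u * Real.exp (-s * Real.cosh u) +
      Real.exp (-u) * Real.exp (-s * Real.cosh u) =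
      2 * (Real.exp (-s * Real.cosh |u|) * Real.cosh |u|) := by
    intro u
    rw [Real.cosh_abs, ← add_mul]
    have := Real.cosh_eq u
    linear_combination -2 * Real.exp (-s * Real.cosh u) * this
  simp_rw [hcosh] at hadd
  rw [integral_const_mul,
    integral_comp_abs (f := fun u => Real.exp (-s * Real.cosh u) * Real.cosh u), hneg] at hadd
  simp only [besselK, one_mul]
  linarith

/-- The classical Laplace-type representation of `K₁` for real arguments. -/
lemma integral_exp_neg_mul_mul_exp_neg_div {p x : ℝ} (hp : 0 < p) (hx : 0 < x) :
    ∫ t in Set.Ioi (0:ℝ), Real.exp (-x * t) * Real.exp (-p / t) =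
      2 * √(p / x) * besselK 1 (2 * √(p * x)) := by
  have hc : 0 < √(p / x) := Real.sqrt_pos.2 (by positivity)
  have h := integral_image_eq_integral_abs_deriv_smul (f := fun u => √(p / x) * Real.exp u)
    (f' := fun u => √(p / x) * Real.exp u) MeasurableSet.univ
    (fun u _ => ((Real.hasDerivAt_exp u).const_mul _).hasDerivWithinAt)
    (fun a _ b _ hab => by simpa [hc.ne'] using hab)
    (fun t => Real.exp (-x * t) * Real.exp (-p / t))
  rw [image_const_mul_exp_univ hc] at h
  rw [h, setIntegral_univ]
  simp only [exp_comp_const_mul_exp hp hx, smul_eq_mul, abs_mul, Real.abs_exp, abs_of_pos hc]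
  simp_rw [mul_assoc]
  rw [integral_const_mul]
  simp_rw [← mul_assoc]
  rw [integral_exp_mul_exp_neg_mul_cosh (by positivity)]
  ring

lemma besselKC_ofReal (ν x : ℝ) : besselKC ν x = besselK ν x := by
  simp only [besselKC, besselK]
  rw [← integral_complex_ofReal]
  simp

lemma differentiableOn_besselKC_one : DifferentiableOn ℂ (besselKC 1) {z : ℂ | 0 < z.re} := by
  have h := differentiableOn_setIntegral_cexp_neg_mul (g := Real.cosh) (w := Real.cosh)
    Real.continuous_cosh.measurable
    (fun t => (Real.cosh_pos t).le)
    (fun x hx => (integrable_exp_neg_mul_cosh_mul_cosh hx).integrableOn)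
  refine h.congr fun z _ => ?_
  simp [besselKC]

lemma re_cpow_half_pos {z : ℂ} (hz : 0 < z.re) : 0 < (z ^ (1/2 : ℂ)).re := by
  have hz0 : z ≠ 0 := by rintro rfl; simp at hz
  have harg := Complex.abs_arg_lt_pi_div_two_iff.2 (Or.inl hz)
  rw [Complex.cpow_def_of_ne_zero hz0, Complex.exp_re]
  refine mul_pos (Real.exp_pos _) (Real.cos_pos_of_mem_Ioo ?_)
  have him : (Complex.log z * (1 / 2)).im = z.arg / 2 := by
    rw [show (1 / 2 : ℂ) = ((1 / 2 : ℝ) : ℂ) by norm_num, Complex.im_mul_ofReal, Complex.log_im]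
    ring
  rw [him]
  have := abs_lt.1 harg
  constructor <;> linarith [Real.pi_pos]

/-- The Laplace-type representation of `K₁` on the right half-plane. -/
lemma integral_cexp_neg_mul_mul_exp_neg_div {p : ℝ} (hp : 0 < p) {z : ℂ} (hz : 0 < z.re) :
    ∫ t in Set.Ioi (0:ℝ), Complex.exp (-z * (t : ℂ)) * (Real.exp (-p / t) : ℂ) =
      2 * (√p : ℂ) * (besselKC 1 (2 * ((p : ℂ) * z) ^ (1/2 : ℂ)) / z ^ (1/2 : ℂ)) := by
  have hU : IsOpen {z : ℂ | 0 < z.re} := isOpen_lt continuous_const Complex.continuous_re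
  have hconv : Convex ℝ {z : ℂ | 0 < z.re} := convex_halfSpace_re_gt 0
  have hF := differentiableOn_setIntegral_cexp_neg_mul (g := fun t => t)
    (w := fun t => Real.exp (-p / t)) (by fun_prop) (fun t => (Real.exp_pos _).le)
    (fun x hx => integrableOn_exp_neg_mul_mul_exp_neg_div hp hx)
  have hpz : ∀ z : ℂ, 0 < z.re → 0 < ((p : ℂ) * z).re := fun z hz => by
    rw [Complex.re_ofReal_mul]; positivity
  have hG : DifferentiableOn ℂ (fun z : ℂ => 2 * (√p : ℂ) *
      (besselKC 1 (2 * ((p : ℂ) * z) ^ (1/2 : ℂ)) / z ^ (1/2 : ℂ))) {z : ℂ | 0 < z.re} := by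
    refine DifferentiableOn.const_mul (DifferentiableOn.fun_div ?_ ?_ ?_) _
    · have h : DifferentiableOn ℂ (fun z : ℂ => ((p : ℂ) * z) ^ (1/2 : ℂ)) {z : ℂ | 0 < z.re} :=
        DifferentiableOn.cpow_const (by fun_prop) fun z hz => Or.inl (hpz z hz)
      refine DifferentiableOn.comp (g := besselKC 1) differentiableOn_besselKC_one
        (h.const_mul 2) fun z hz => ?_
      have := re_cpow_half_pos (hpz z hz)
      simpa using this
    · exact DifferentiableOn.cpow_const (by fun_prop) fun z hz => Or.inl hz
    · intro z hz h0
      have := re_cpow_half_pos hz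
      rw [h0] at this
      exact lt_irrefl _ this
  refine (hF.analyticOnNhd hU).eqOn_of_preconnected_of_frequently_eq (hG.analyticOnNhd hU)
    hconv.isPreconnected (z₀ := 1) (by simp) ?_ hz
  have hreal : ∀ x : ℝ, 0 < x →
      ∫ t in Set.Ioi (0:ℝ), Complex.exp (-(x : ℂ) * (t : ℂ)) * (Real.exp (-p / t) : ℂ) =
      2 * (√p : ℂ) * (besselKC 1 (2 * ((p : ℂ) * x) ^ (1/2 : ℂ)) / (x : ℂ) ^ (1/2 : ℂ)) := by
    intro x hx
    have hsq : ∀ y : ℝ, 0 ≤ y → (y : ℂ) ^ (1/2 : ℂ) = (√y : ℂ) := by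
      intro y hy
      rw [Real.sqrt_eq_rpow, Complex.ofReal_cpow hy]
      norm_num
    rw [← Complex.ofReal_mul, hsq _ (by positivity), hsq _ hx.le]
    have h := congrArg (fun y : ℝ => (y : ℂ)) (integral_exp_neg_mul_mul_exp_neg_div hp hx)
    simp only [← integral_complex_ofReal] at h
    rw [Real.sqrt_div hp.le] at h
    have h2 := besselKC_ofReal 1 (2 * √(p * x))
    push_cast at h h2 ⊢
    rw [h, h2]
    ring
  have htend : Filter.Tendsto (fun x : ℝ => (x : ℂ)) (nhdsWithin 1 {1}ᶜ)
      (nhdsWithin (1 : ℂ) {1}ᶜ) := by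
    refine tendsto_nhdsWithin_iff.2 ⟨?_, ?_⟩
    · exact (Complex.continuous_ofReal.tendsto' 1 1 (by simp)).mono_left nhdsWithin_le_nhds
    · filter_upwards [self_mem_nhdsWithin] with x hx
      simpa using hx
  refine htend.frequently (Filter.Eventually.frequently ?_)
  filter_upwards [nhdsWithin_le_nhds (lt_mem_nhds (zero_lt_one (α := ℝ)))] with x hx
  exact hreal x hx

lemma hasSum_exp_neg_succ_mul {t : ℝ} (ht : 0 < t) :
    HasSum (fun k : ℕ => Real.exp (-((k : ℝ) + 1) * t)) (Real.exp t - 1)⁻¹ := by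
  have h := (hasSum_geometric_of_lt_one (Real.exp_pos (-t)).le
    (Real.exp_lt_one_iff.2 (neg_lt_zero.2 ht))).mul_left (Real.exp (-t))
  have hterm : (fun k : ℕ => Real.exp (-((k : ℝ) + 1) * t)) =
      fun k : ℕ => Real.exp (-t) * Real.exp (-t) ^ k := by
    ext k
    rw [← Real.exp_nat_mul, ← Real.exp_add]
    ring_nf
  have hval : (Real.exp t - 1)⁻¹ = Real.exp (-t) * (1 - Real.exp (-t))⁻¹ := by
    have h2 : (1 - Real.exp (-t)) * Real.exp t = Real.exp t - 1 := by
      rw [sub_mul, ← Real.exp_add]; simp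
    rw [← h2, mul_inv, Real.exp_neg]
    ring
  rwa [hterm, hval]

/-- The Planck-type kernel is dominated by a multiple of `exp (-t)`. -/
lemma exp_neg_div_div_exp_sub_one_le {p t : ℝ} (hp : 0 < p) (ht : 0 < t) :
    Real.exp (-p / t) / (Real.exp t - 1) ≤ (1 + 1 / p) * Real.exp (-t) := by
  have hexp : 0 < Real.exp t - 1 := by linarith [Real.add_one_lt_exp ht.ne']
  have h1 : t * Real.exp t ≤ (1 + t) * (Real.exp t - 1) := by
    linarith [Real.add_one_le_exp t]
  have h2 : Real.exp (-p / t) ≤ t / p := by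
    have := Real.add_one_le_exp (p / t)
    rw [neg_div, Real.exp_neg, ← inv_div p t]
    exact inv_anti₀ (by positivity) (by linarith)
  have h3 := exp_neg_div_le_one hp ht
  rw [div_le_iff₀ hexp, Real.exp_neg, mul_assoc, inv_mul_eq_div, mul_div_assoc',
    le_div_iff₀ (Real.exp_pos t)]
  have h4 : Real.exp (-p / t) * (1 + t) ≤ (1 + 1 / p) * t := by
    have := mul_le_mul_of_nonneg_right h3 ht.le
    have e : (1 + 1 / p) * t = t + t / p := by ring
    linarith
  have h5 := mul_le_mul_of_nonneg_left h1 (Real.exp_pos (-p / t)).le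
  have h6 := mul_le_mul_of_nonneg_right h4 hexp.le
  refine le_of_mul_le_mul_left ?_ ht
  linarith

lemma integrableOn_cosh_mul_exp_neg_div_div {p γ : ℝ} (hp : 0 < p) (hγ : |γ| < 1) :
    IntegrableOn (fun t => Real.cosh (γ * t) * (Real.exp (-p / t) / (Real.exp t - 1)))
      (Set.Ioi 0) := by
  refine Integrable.mono' ((exp_neg_integrableOn_Ioi 0 (b := 1 - |γ|) (by linarith)).const_mul
    (1 + 1 / p)) (Measurable.aestronglyMeasurable (by fun_prop)) ?_
  refine (ae_restrict_iff' measurableSet_Ioi).2 (Filter.Eventually.of_forall fun t ht => ?_)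
  have ht : 0 < t := ht
  have hexp : 0 < Real.exp t - 1 := by linarith [Real.add_one_lt_exp ht.ne']
  have hcosh : Real.cosh (γ * t) ≤ Real.exp (|γ| * t) := by
    have : |γ| * t = |γ * t| := by rw [abs_mul, abs_of_pos ht]
    rw [this, ← Real.cosh_abs, Real.cosh_eq]
    have := Real.exp_le_exp.2 (neg_le_self (abs_nonneg (γ * t)))
    linarith
  rw [Real.norm_of_nonneg (by positivity)]
  calc _ ≤ Real.exp (|γ| * t) * ((1 + 1 / p) * Real.exp (-t)) := by
        gcongr
        exact exp_neg_div_div_exp_sub_one_le hp ht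
    _ = _ := by
        rw [mul_left_comm, ← Real.exp_add]
        ring_nf

lemma integrableOn_exp_neg_div_div {p : ℝ} (hp : 0 < p) :
    IntegrableOn (fun t => Real.exp (-p / t) / (Real.exp t - 1)) (Set.Ioi 0) := by
  simpa using integrableOn_cosh_mul_exp_neg_div_div (γ := 0) hp (by simp)

lemma mathieuS_zero_term (p γ : ℝ) (n : ℕ) :
    (-1 : ℝ) ^ n * (Real.Gamma (0 + n + 1) / (n.factorial * Real.Gamma (0 + 1))) *
      zetaP p (2 * 0 + 2 * n + 1) * γ ^ (2 * n) =
    ∫ t in Set.Ioi (0:ℝ), (-1) ^ n * (γ * t) ^ (2 * n) / ((2 * n).factorial : ℝ) *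
      (Real.exp (-p / t) / (Real.exp t - 1)) := by
  have hn : (n.factorial : ℝ) ≠ 0 := by exact_mod_cast n.factorial_ne_zero
  have hΓ : Real.Gamma (2 * 0 + 2 * n + 1) = ((2 * n).factorial : ℝ) := by
    rw [← Real.Gamma_nat_eq_factorial]
    congr 1
    push_cast
    ring
  have hpow : ∀ t : ℝ, t ^ ((2 * 0 + 2 * (n : ℝ) + 1) - 1) = t ^ (2 * n) := by
    intro t
    rw [← Real.rpow_natCast]
    congr 1
    push_cast
    ring
  rw [zetaP, hΓ]
  simp only [hpow, zero_add, Real.Gamma_nat_eq_factorial, Real.Gamma_one, mul_one, div_self hn]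
  rw [mul_comm _ (γ ^ (2 * n)), ← mul_assoc, ← mul_assoc, ← integral_const_mul]
  refine integral_congr_ae (Filter.Eventually.of_forall fun t => ?_)
  simp only [mul_pow]
  ring

/-- The `μ = 0` extended Mathieu series as a cosine integral. -/
lemma mathieuS_zero_eq_integral {p γ : ℝ} (hp : 0 < p) (hγ : |γ| < 1) :
    mathieuS 0 p γ = 2 * ∫ t in Set.Ioi (0:ℝ),
      Real.cos (γ * t) * (Real.exp (-p / t) / (Real.exp t - 1)) := by
  rw [mathieuS]
  congr 1
  simp_rw [mathieuS_zero_term]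
  have hcosh : ∀ t : ℝ, HasSum (fun n : ℕ => (γ * t) ^ (2 * n) / ((2 * n).factorial : ℝ) *
      (Real.exp (-p / t) / (Real.exp t - 1)))
      (Real.cosh (γ * t) * (Real.exp (-p / t) / (Real.exp t - 1))) :=
    fun t => (Real.hasSum_cosh (γ * t)).mul_right _
  have hcos : ∀ t : ℝ, HasSum (fun n : ℕ => (-1) ^ n * (γ * t) ^ (2 * n) /
      ((2 * n).factorial : ℝ) * (Real.exp (-p / t) / (Real.exp t - 1)))
      (Real.cos (γ * t) * (Real.exp (-p / t) / (Real.exp t - 1))) :=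
    fun t => (Real.hasSum_cos (γ * t)).mul_right _
  refine HasSum.tsum_eq (hasSum_integral_of_dominated_convergence
    (fun n t => (γ * t) ^ (2 * n) / ((2 * n).factorial : ℝ) *
      (Real.exp (-p / t) / (Real.exp t - 1)))
    (fun n => Measurable.aestronglyMeasurable (by fun_prop)) (fun n => ?_)
    (Filter.Eventually.of_forall fun t => (hcosh t).summable) ?_
    (Filter.Eventually.of_forall hcos))
  · refine (ae_restrict_iff' measurableSet_Ioi).2 (Filter.Eventually.of_forall fun t ht => ?_)
    have ht : 0 < t := ht
    have hexp : 0 < Real.exp t - 1 := by linarith [Real.add_one_lt_exp ht.ne']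
    have hev : |γ * t| ^ (2 * n) = (γ * t) ^ (2 * n) := (even_two_mul n).pow_abs _
    simp [abs_mul, abs_of_pos hexp, ← hev]
  · simp_rw [fun t => (hcosh t).tsum_eq]
    exact integrableOn_cosh_mul_exp_neg_div_div hp hγ

lemma integrableOn_cexp_neg_mul_mul_exp_neg_div {p : ℝ} (hp : 0 < p) {z : ℂ} (hz : 0 < z.re) :
    IntegrableOn (fun t : ℝ => Complex.exp (-z * (t : ℂ)) * (Real.exp (-p / t) : ℂ))
      (Set.Ioi 0) := by
  refine Integrable.mono' (integrableOn_exp_neg_mul_mul_exp_neg_div hp hz)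
    (Measurable.aestronglyMeasurable (by fun_prop)) (Filter.Eventually.of_forall fun t => ?_)
  rw [norm_mul, Complex.norm_exp, Complex.norm_real, Real.norm_of_nonneg (Real.exp_pos _).le,
    Complex.re_mul_ofReal, Complex.neg_re]

lemma integral_cexp_add_integral_cexp_conj {p : ℝ} (hp : 0 < p) (γ : ℝ) (k : ℕ) :
    (∫ t in Set.Ioi (0:ℝ), Complex.exp (-(((k : ℂ) + 1) + Complex.I * γ) * (t : ℂ)) *
        (Real.exp (-p / t) : ℂ)) +
      (∫ t in Set.Ioi (0:ℝ), Complex.exp (-(((k : ℂ) + 1) - Complex.I * γ) * (t : ℂ)) *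
        (Real.exp (-p / t) : ℂ)) =
    ((2 * ∫ t in Set.Ioi (0:ℝ), Real.cos (γ * t) * Real.exp (-p / t) *
      Real.exp (-((k : ℝ) + 1) * t) : ℝ) : ℂ) := by
  have hk : (0:ℝ) < k + 1 := by positivity
  rw [← integral_add (integrableOn_cexp_neg_mul_mul_exp_neg_div hp (by simpa using hk))
    (integrableOn_cexp_neg_mul_mul_exp_neg_div hp (by simpa using hk)),
    ← integral_const_mul, ← integral_complex_ofReal]
  refine integral_congr_ae (Filter.Eventually.of_forall fun t => ?_)
  have h1 : -(((k : ℂ) + 1) + Complex.I * γ) * (t : ℂ) =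
      -((k : ℂ) + 1) * t + -(γ * t) * Complex.I := by ring
  have h2 : -(((k : ℂ) + 1) - Complex.I * γ) * (t : ℂ) =
      -((k : ℂ) + 1) * t + (γ * t) * Complex.I := by ring
  simp only [h1, h2, Complex.exp_add]
  push_cast
  rw [Complex.cos]
  ring

lemma integral_cos_mul_eq_tsum {p : ℝ} (hp : 0 < p) (γ : ℝ) :
    ∫ t in Set.Ioi (0:ℝ), Real.cos (γ * t) * (Real.exp (-p / t) / (Real.exp t - 1)) =
      ∑' k : ℕ, ∫ t in Set.Ioi (0:ℝ), Real.cos (γ * t) * Real.exp (-p / t) *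
        Real.exp (-((k : ℝ) + 1) * t) := by
  have hsum : ∀ t : ℝ, 0 < t → HasSum (fun k : ℕ => Real.exp (-p / t) *
      Real.exp (-((k : ℝ) + 1) * t)) (Real.exp (-p / t) / (Real.exp t - 1)) :=
    fun t ht => (hasSum_exp_neg_succ_mul ht).mul_left _
  refine (hasSum_integral_of_dominated_convergence
    (fun (k : ℕ) t => Real.exp (-p / t) * Real.exp (-((k : ℝ) + 1) * t))
    (fun n => Measurable.aestronglyMeasurable (by fun_prop))
    (fun n => Filter.Eventually.of_forall fun t => ?_)
    ((ae_restrict_iff' measurableSet_Ioi).2 (Filter.Eventually.of_forall fun t ht =>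
      (hsum t ht).summable)) ?_
    ((ae_restrict_iff' measurableSet_Ioi).2
      (Filter.Eventually.of_forall fun t ht => ?_))).tsum_eq.symm
  · rw [norm_mul, norm_mul, Real.norm_of_nonneg (Real.exp_pos _).le,
      Real.norm_of_nonneg (Real.exp_pos _).le, mul_assoc]
    exact mul_le_of_le_one_left (by positivity) (Real.abs_cos_le_one _)
  · refine (integrableOn_exp_neg_div_div hp).congr_fun (fun t ht => ?_) measurableSet_Ioi
    exact (hsum t ht).tsum_eq.symm
  · simp_rw [mul_assoc]
    exact (hsum t ht).mul_left _

theorem stmt3 (p γ : ℝ) (hp : 0 < p) (hγ0 : 0 < γ) (hγ1 : γ < 1) :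
    (mathieuS 0 p γ : ℂ) =
      2 * (Real.sqrt p : ℂ) *
        ∑' k : ℕ,
          (besselKC 1 (2 * ((p : ℂ) * (((k : ℂ) + 1) + Complex.I * γ)) ^ (1/2 : ℂ)) /
              (((k : ℂ) + 1) + Complex.I * γ) ^ (1/2 : ℂ) +
            besselKC 1 (2 * ((p : ℂ) * (((k : ℂ) + 1) - Complex.I * γ)) ^ (1/2 : ℂ)) /
              (((k : ℂ) + 1) - Complex.I * γ) ^ (1/2 : ℂ)) := by
  rw [mathieuS_zero_eq_integral hp (by rwa [abs_of_pos hγ0]), integral_cos_mul_eq_tsum hp,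
    ← tsum_mul_left, ← tsum_mul_left, Complex.ofReal_tsum]
  refine tsum_congr fun k => ?_
  have hk : (0:ℝ) < k + 1 := by positivity
  rw [← integral_cexp_add_integral_cexp_conj hp,
    integral_cexp_neg_mul_mul_exp_neg_div hp (by simpa using hk),
    integral_cexp_neg_mul_mul_exp_neg_div hp (by simpa using hk), ← mul_add]
end

section
/- Let p > 0 and 0 < r < 1. Then S_{2,p}(r) = (1/(2r)²) S_{1,p}(r) − (1/(2r)²) ∑_{k≥1} ∫_0^∞ x² e^{−kx − p/x} cos(rx) dx. -/
open Real MeasureTheory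

/-- The kernel `e^{-p/t} / (e^t - 1)` of the extended zeta function is dominated by
`e^{-t} (1 + 1/t)`. -/
lemma pow_mul_zetaKernel_le {p t : ℝ} (hp : 0 < p) (ht : 0 < t) (m : ℕ) :
    t ^ (m + 1) * (exp (-p / t) / (exp t - 1)) ≤
      exp (-t) * t ^ (m + 1) + exp (-t) * t ^ m := by
  have h1 : exp (-p / t) ≤ 1 := exp_le_one_iff.2 (div_nonpos_of_nonpos_of_nonneg (by linarith) ht.le)
  have h2 : t ≤ exp t - 1 := by linarith [add_one_le_exp t]
  have h3 : exp (-p / t) / (exp t - 1) ≤ 1 / (exp t - 1) :=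
    div_le_div_of_nonneg_right h1 (by linarith)
  have h4 : 1 / (exp t - 1) ≤ exp (-t) + exp (-t) / t := by
    have hpos : 0 < exp t - 1 := by linarith
    rw [exp_neg, div_le_iff₀ hpos]
    have := exp_pos t
    field_simp
    nlinarith
  calc t ^ (m + 1) * (exp (-p / t) / (exp t - 1))
      ≤ t ^ (m + 1) * (exp (-t) + exp (-t) / t) := by gcongr; exact h3.trans h4
    _ = exp (-t) * t ^ (m + 1) + exp (-t) * t ^ m := by field_simp; ring

lemma zetaKernel_nonneg {t : ℝ} (p : ℝ) (ht : 0 < t) : 0 ≤ exp (-p / t) / (exp t - 1) :=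
  div_nonneg (exp_pos _).le (by linarith [add_one_le_exp t])

lemma integrableOn_exp_neg_mul_pow (m : ℕ) :
    IntegrableOn (fun t : ℝ => exp (-t) * t ^ m) (Set.Ioi 0) := by
  have h := Real.GammaIntegral_convergent (s := (m : ℝ) + 1) (by positivity)
  simpa using h

lemma integral_exp_neg_mul_pow (m : ℕ) :
    ∫ t in Set.Ioi (0 : ℝ), exp (-t) * t ^ m = m.factorial := by
  have h := Real.Gamma_eq_integral (s := (m : ℝ) + 1) (by positivity)
  rw [Real.Gamma_nat_eq_factorial] at h
  simpa using h.symm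

lemma integrableOn_pow_mul_zetaKernel {p : ℝ} (hp : 0 < p) (m : ℕ) :
    IntegrableOn (fun t : ℝ => t ^ (m + 1) * (exp (-p / t) / (exp t - 1))) (Set.Ioi 0) := by
  refine ((integrableOn_exp_neg_mul_pow (m + 1)).add (integrableOn_exp_neg_mul_pow m)).mono'
    (by fun_prop) ?_
  filter_upwards [ae_restrict_mem measurableSet_Ioi] with t (ht : 0 < t)
  rw [Real.norm_of_nonneg (mul_nonneg (by positivity) (zetaKernel_nonneg p ht))]
  exact pow_mul_zetaKernel_le hp ht m

lemma integral_pow_mul_zetaKernel_le {p : ℝ} (hp : 0 < p) (m : ℕ) :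
    ∫ t in Set.Ioi (0 : ℝ), t ^ (m + 1) * (exp (-p / t) / (exp t - 1)) ≤
      2 * (m + 1).factorial := by
  calc _ ≤ ∫ t in Set.Ioi (0 : ℝ), (exp (-t) * t ^ (m + 1) + exp (-t) * t ^ m) :=
        setIntegral_mono_on (integrableOn_pow_mul_zetaKernel hp m)
          ((integrableOn_exp_neg_mul_pow (m + 1)).add (integrableOn_exp_neg_mul_pow m))
          measurableSet_Ioi fun t ht => pow_mul_zetaKernel_le hp ht m
    _ = (m + 1).factorial + m.factorial := by
        rw [integral_add (integrableOn_exp_neg_mul_pow (m + 1)) (integrableOn_exp_neg_mul_pow m),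
          integral_exp_neg_mul_pow, integral_exp_neg_mul_pow]
    _ ≤ 2 * (m + 1).factorial := by
        have : (m.factorial : ℝ) ≤ (m + 1).factorial :=
          Nat.cast_le.2 (Nat.factorial_le (Nat.le_succ m))
        linarith

lemma zetaP_natCast_add_one (p : ℝ) (m : ℕ) :
    zetaP p ((m : ℝ) + 1) =
      1 / m.factorial * ∫ t in Set.Ioi (0 : ℝ), t ^ m * (exp (-p / t) / (exp t - 1)) := by
  simp only [zetaP, Real.Gamma_nat_eq_factorial, add_sub_cancel_right, Real.rpow_natCast,
    mul_div_assoc]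

/-- A power series may be integrated term by term against the extended zeta kernel. -/
lemma tsum_mul_integral_zetaKernel {p : ℝ} (hp : 0 < p) {a : ℕ → ℝ} {k : ℕ → ℕ} {f : ℝ → ℝ}
    (ha : Summable fun n => |a n| * (k n + 1).factorial)
    (hf : ∀ t, 0 < t → HasSum (fun n => a n * t ^ (k n + 1)) (f t)) :
    ∑' n, a n * ∫ t in Set.Ioi (0 : ℝ), t ^ (k n + 1) * (exp (-p / t) / (exp t - 1)) =
      ∫ t in Set.Ioi (0 : ℝ), f t * (exp (-p / t) / (exp t - 1)) := by
  have hnorm (n : ℕ) : ∫ t in Set.Ioi (0 : ℝ),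
      ‖a n * (t ^ (k n + 1) * (exp (-p / t) / (exp t - 1)))‖ =
      |a n| * ∫ t in Set.Ioi (0 : ℝ), t ^ (k n + 1) * (exp (-p / t) / (exp t - 1)) := by
    rw [← integral_const_mul]
    refine setIntegral_congr_fun measurableSet_Ioi fun t (ht : 0 < t) => ?_
    rw [norm_mul, Real.norm_eq_abs,
      Real.norm_of_nonneg (mul_nonneg (by positivity) (zetaKernel_nonneg p ht))]
  have h := integral_tsum_of_summable_integral_norm (μ := volume.restrict (Set.Ioi (0 : ℝ)))
    (F := fun n t => a n * (t ^ (k n + 1) * (exp (-p / t) / (exp t - 1))))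
    (fun n => (integrableOn_pow_mul_zetaKernel hp (k n)).const_mul (a n)) (by
      simp only [hnorm]
      refine Summable.of_nonneg_of_le (fun n => mul_nonneg (abs_nonneg _) ?_) (fun n => ?_)
        (ha.mul_left 2)
      · exact setIntegral_nonneg measurableSet_Ioi fun t ht =>
          mul_nonneg (pow_nonneg (le_of_lt ht) _) (zetaKernel_nonneg p ht)
      · rw [mul_left_comm]
        exact mul_le_mul_of_nonneg_left (integral_pow_mul_zetaKernel_le hp _) (abs_nonneg _))
  simp only [integral_const_mul] at h
  rw [h]
  refine setIntegral_congr_fun measurableSet_Ioi fun t ht => ?_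
  simp only [← mul_assoc]
  simpa only [mul_div_assoc, mul_assoc] using
    ((hf t ht).mul_right (exp (-p / t) / (exp t - 1))).tsum_eq

lemma mathieuS_one_eq_integral {p r : ℝ} (hp : 0 < p) (hr0 : 0 < r) (hr1 : r < 1) :
    mathieuS 1 p r =
      ∫ t in Set.Ioi (0 : ℝ), t * sin (r * t) / r * (exp (-p / t) / (exp t - 1)) := by
  rw [← tsum_mul_integral_zetaKernel hp
    (a := fun n => (-1) ^ n * r ^ (2 * n) / (2 * n + 1).factorial) (k := fun n => 2 * n + 1)]
  · rw [mathieuS, ← tsum_mul_left]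
    refine tsum_congr fun n => ?_
    have e1 : (2 * 1 + 2 * n + 1 : ℝ) = ((2 * n + 1 + 1 : ℕ) : ℝ) + 1 := by push_cast; ring
    have e2 : (1 + n + 1 : ℝ) = ((n + 1 : ℕ) : ℝ) + 1 := by push_cast; ring
    have e3 : (1 + 1 : ℝ) = ((1 : ℕ) : ℝ) + 1 := by push_cast; ring
    rw [e1, zetaP_natCast_add_one, e2, e3, Real.Gamma_nat_eq_factorial,
      Real.Gamma_nat_eq_factorial]
    simp only [Nat.factorial_succ (2 * n + 1), Nat.factorial_succ n]
    push_cast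
    have := Nat.factorial_ne_zero n
    have := Nat.factorial_ne_zero (2 * n + 1)
    simp only [Nat.factorial_one, Nat.cast_one]
    field_simp
    ring
  · have hr2 : ‖r ^ 2‖ < 1 := by rw [Real.norm_of_nonneg (by positivity)]; nlinarith
    refine (((summable_pow_mul_geometric_of_norm_lt_one 1 hr2).mul_left 2).add
      ((summable_geometric_of_norm_lt_one hr2).mul_left 2)).congr fun n => ?_
    rw [abs_div, abs_mul, abs_pow, abs_neg, abs_one, one_pow, one_mul, Nat.abs_cast,
      abs_of_pos (by positivity), Nat.factorial_succ (2 * n + 1), pow_mul]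
    have := Nat.factorial_ne_zero (2 * n + 1)
    push_cast
    field_simp
    ring
  · intro t ht
    rw [mul_div_right_comm]
    refine ((Real.hasSum_sin (r * t)).mul_left (t / r)).congr_fun fun n => ?_
    field_simp
    ring

lemma mathieuS_two_eq_integral {p r : ℝ} (hp : 0 < p) (hr0 : 0 < r) (hr1 : r < 1) :
    mathieuS 2 p r = ∫ t in Set.Ioi (0 : ℝ),
      1 / (2 * r) ^ 2 * (t * sin (r * t) / r - t ^ 2 * cos (r * t)) *
        (exp (-p / t) / (exp t - 1)) := by
  rw [← tsum_mul_integral_zetaKernel hp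
    (a := fun n => (-1) ^ n * r ^ (2 * n) * (n + 1) / (2 * (2 * n + 3).factorial))
    (k := fun n => 2 * n + 3)]
  · rw [mathieuS, ← tsum_mul_left]
    refine tsum_congr fun n => ?_
    have e1 : (2 * 2 + 2 * n + 1 : ℝ) = ((2 * n + 3 + 1 : ℕ) : ℝ) + 1 := by push_cast; ring
    have e2 : (2 + n + 1 : ℝ) = ((n + 1 + 1 : ℕ) : ℝ) + 1 := by push_cast; ring
    have e3 : (2 + 1 : ℝ) = ((2 : ℕ) : ℝ) + 1 := by push_cast; ring
    rw [e1, zetaP_natCast_add_one, e2, e3, Real.Gamma_nat_eq_factorial,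
      Real.Gamma_nat_eq_factorial]
    simp only [Nat.factorial_succ (2 * n + 3), Nat.factorial_succ (n + 1), Nat.factorial_succ n]
    push_cast
    have := Nat.factorial_ne_zero n
    have := Nat.factorial_ne_zero (2 * n + 3)
    simp only [Nat.factorial_two, Nat.cast_ofNat]
    field_simp
    ring
  · have hr2 : ‖r ^ 2‖ < 1 := by rw [Real.norm_of_nonneg (by positivity)]; nlinarith
    refine ((summable_pow_mul_geometric_of_norm_lt_one 2 hr2).add
      (((summable_pow_mul_geometric_of_norm_lt_one 1 hr2).mul_left 3).add
      ((summable_geometric_of_norm_lt_one hr2).mul_left 2))).congr fun n => ?_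
    rw [abs_div, abs_mul, abs_mul, abs_pow, abs_neg, abs_one, one_pow, one_mul,
      abs_of_pos (by positivity : 0 < r ^ (2 * n)), abs_of_pos (by positivity : (0 : ℝ) < n + 1),
      abs_of_pos (by positivity), Nat.factorial_succ (2 * n + 3), pow_mul]
    have := Nat.factorial_ne_zero (2 * n + 3)
    push_cast
    field_simp
    ring
  · intro t ht
    have h := ((Real.hasSum_sin (r * t)).mul_left (1 / (2 * r) ^ 2 * (t / r))).sub
      ((Real.hasSum_cos (r * t)).mul_left (1 / (2 * r) ^ 2 * t ^ 2))
    rw [← hasSum_nat_add_iff' 1] at h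
    have hval : 1 / (2 * r) ^ 2 * (t / r) * sin (r * t) - 1 / (2 * r) ^ 2 * t ^ 2 * cos (r * t) -
        ∑ i ∈ Finset.range 1, (1 / (2 * r) ^ 2 * (t / r) *
          ((-1) ^ i * (r * t) ^ (2 * i + 1) / (2 * i + 1).factorial) -
            1 / (2 * r) ^ 2 * t ^ 2 * ((-1) ^ i * (r * t) ^ (2 * i) / (2 * i).factorial)) =
        1 / (2 * r) ^ 2 * (t * sin (r * t) / r - t ^ 2 * cos (r * t)) := by
      simp only [Finset.sum_range_one, mul_zero, zero_add, pow_zero, pow_one, Nat.factorial_zero,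
        Nat.factorial_one, Nat.cast_one]
      field_simp
      ring
    rw [hval] at h
    refine h.congr_fun fun n => ?_
    rw [show 2 * (n + 1) + 1 = 2 * n + 2 + 1 by ring, show 2 * (n + 1) = 2 * n + 2 by ring,
      Nat.factorial_succ (2 * n + 2)]
    have := Nat.factorial_ne_zero (2 * n + 2)
    push_cast
    field_simp
    ring

lemma tsum_integral_exp_mul_cos {p : ℝ} (hp : 0 < p) (r : ℝ) :
    ∑' k : ℕ, ∫ x in Set.Ioi (0 : ℝ),
        x ^ 2 * exp (-((k : ℝ) + 1) * x - p / x) * cos (r * x) =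
      ∫ x in Set.Ioi (0 : ℝ), x ^ 2 * cos (r * x) * (exp (-p / x) / (exp x - 1)) := by
  have hint (k : ℕ) : IntegrableOn (fun x : ℝ => x ^ 2 * exp (-(((k : ℝ) + 1) * x)))
      (Set.Ioi 0) := by
    have h := integrableOn_rpow_mul_exp_neg_mul_rpow (p := 1) (s := 2) (b := (k : ℝ) + 1)
      (by norm_num) (by norm_num) (by positivity)
    refine h.congr_fun (fun x _ => ?_) measurableSet_Ioi
    simp only [Real.rpow_ofNat, Real.rpow_one, neg_mul]
  have hval (k : ℕ) : ∫ x in Set.Ioi (0 : ℝ), x ^ 2 * exp (-(((k : ℝ) + 1) * x)) =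
      2 * (1 / ((k + 1 : ℕ) : ℝ) ^ 3) := by
    have h := Real.integral_rpow_mul_exp_neg_mul_Ioi (a := 3) (r := (k : ℝ) + 1)
      (by norm_num) (by positivity)
    have e : (3 : ℝ) = ((2 : ℕ) : ℝ) + 1 := by norm_num
    rw [e, Real.Gamma_nat_eq_factorial, add_sub_cancel_right] at h
    simp only [Real.rpow_natCast] at h
    rw [h, ← e, show (3 : ℝ) = ((3 : ℕ) : ℝ) by norm_num, Real.rpow_natCast]
    simp [mul_comm]
  have hbound (k : ℕ) (x : ℝ) (hx : 0 < x) :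
      ‖x ^ 2 * exp (-((k : ℝ) + 1) * x - p / x) * cos (r * x)‖ ≤
        x ^ 2 * exp (-(((k : ℝ) + 1) * x)) := by
    rw [norm_mul, Real.norm_of_nonneg (by positivity)]
    refine (mul_le_of_le_one_right (by positivity) (abs_cos_le_one _)).trans ?_
    have : 0 < p / x := by positivity
    gcongr
    linarith
  have hint' (k : ℕ) : IntegrableOn
      (fun x : ℝ => x ^ 2 * exp (-((k : ℝ) + 1) * x - p / x) * cos (r * x)) (Set.Ioi 0) := by
    refine (hint k).mono' (by fun_prop) ?_
    filter_upwards [ae_restrict_mem measurableSet_Ioi] with x hx using hbound k x hx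
  rw [integral_tsum_of_summable_integral_norm hint']
  · refine setIntegral_congr_fun measurableSet_Ioi fun x (hx : 0 < x) => ?_
    have hlt : exp (-x) < 1 := by rw [exp_lt_one_iff]; linarith
    have h := (hasSum_geometric_of_lt_one (exp_pos (-x)).le hlt).mul_left
      (x ^ 2 * cos (r * x) * exp (-p / x) * exp (-x))
    convert h.tsum_eq using 1
    · refine tsum_congr fun k => ?_
      have : exp (-((k : ℝ) + 1) * x - p / x) = exp (-p / x) * exp (-x) * exp (-x) ^ k := by
        rw [← exp_nat_mul, ← exp_add, ← exp_add]
        congr 1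
        ring
      rw [this]
      ring
    · have h1 : exp x - 1 ≠ 0 := (by linarith [add_one_le_exp x] : 0 < exp x - 1).ne'
      rw [exp_neg x]
      have := exp_ne_zero x
      have h2 : 1 - (exp x)⁻¹ ≠ 0 := by rw [exp_neg] at hlt; exact (sub_pos.2 hlt).ne'
      field_simp
  · refine Summable.of_nonneg_of_le (fun k => integral_nonneg fun x => norm_nonneg _)
      (fun k => (setIntegral_mono_on (hint' k).norm (hint k) measurableSet_Ioi
        (hbound k)).trans_eq (hval k)) ?_
    exact ((summable_nat_add_iff 1).2
      (Real.summable_one_div_nat_pow.2 (by norm_num : 1 < 3))).mul_left 2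

theorem stmt8 (p r : ℝ) (hp : 0 < p) (hr0 : 0 < r) (hr1 : r < 1) :
    mathieuS 2 p r =
      (1 / (2 * r) ^ 2) * mathieuS 1 p r -
        (1 / (2 * r) ^ 2) * ∑' k : ℕ,
          ∫ x in Set.Ioi (0:ℝ), x ^ 2 * Real.exp (-((k : ℝ) + 1) * x - p / x) * Real.cos (r * x) := by
  have hs : IntegrableOn (fun t : ℝ => t * sin (r * t) / r * (exp (-p / t) / (exp t - 1)))
      (Set.Ioi 0) := by
    have h := (integrableOn_pow_mul_zetaKernel hp 0).mul_bdd (c := 1)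
      (g := fun t : ℝ => sin (r * t)) (by fun_prop)
      (Filter.Eventually.of_forall fun t => abs_sin_le_one _)
    refine (h.div_const r).congr (Filter.Eventually.of_forall fun t => ?_)
    dsimp only
    ring
  have hc : IntegrableOn (fun t : ℝ => t ^ 2 * cos (r * t) * (exp (-p / t) / (exp t - 1)))
      (Set.Ioi 0) := by
    have h := (integrableOn_pow_mul_zetaKernel hp 1).mul_bdd (c := 1)
      (g := fun t : ℝ => cos (r * t)) (by fun_prop)
      (Filter.Eventually.of_forall fun t => abs_cos_le_one _)
    refine h.congr (Filter.Eventually.of_forall fun t => ?_)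
    dsimp only
    ring
  rw [mathieuS_two_eq_integral hp hr0 hr1, mathieuS_one_eq_integral hp hr0 hr1,
    tsum_integral_exp_mul_cos hp, ← mul_sub, ← integral_sub hs hc, ← integral_const_mul]
  refine integral_congr_ae (Filter.Eventually.of_forall fun t => ?_)
  dsimp only
  ring
end

section
/- Let p > 0 and 0 < r < 1. Then S_{0,p}(r) = 2 ∫_0^∞ e^{−p/x} cos(rx) (e^x − 1)^{−1} dx. -/
open Real MeasureTheory

lemma integrableOn_cosh_mul_exp_neg_div_div_exp_sub_one {p r : ℝ} (hp : 0 < p) (hr0 : 0 ≤ r)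
    (hr1 : r < 1) :
    IntegrableOn (fun t : ℝ => Real.cosh (r * t) * (Real.exp (-p / t) / (Real.exp t - 1)))
      (Set.Ioi 0) := by
  have hI := (exp_neg_integrableOn_Ioi 0 (sub_pos.2 hr1)).const_mul (1 + 1 / p)
  refine hI.mono' (Measurable.aestronglyMeasurable (by fun_prop)) ?_
  filter_upwards [ae_restrict_mem measurableSet_Ioi] with t ht
  have ht : 0 < t := ht
  have h0 : 0 < Real.exp t - 1 := by linarith [Real.add_one_le_exp t]
  have hc : Real.cosh (r * t) ≤ Real.exp (r * t) := by
    rw [Real.cosh_eq]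
    have : Real.exp (-(r * t)) ≤ Real.exp (r * t) :=
      Real.exp_le_exp.2 (by linarith [mul_nonneg hr0 ht.le])
    linarith
  rw [Real.norm_of_nonneg (by have := Real.cosh_pos (r * t); positivity)]
  calc Real.cosh (r * t) * (Real.exp (-p / t) / (Real.exp t - 1))
      ≤ Real.exp (r * t) * ((1 + 1 / p) * Real.exp (-t)) := by
        gcongr
        exact exp_neg_div_div_exp_sub_one_le hp ht
    _ = (1 + 1 / p) * Real.exp (-(1 - r) * t) := by
        rw [mul_left_comm, ← Real.exp_add]
        ring_nf

/-- The cosine series integrated term by term against `e^{-p/t} / (e^t - 1)`. -/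
lemma hasSum_integral_cos_mul_exp_neg_div_div_exp_sub_one {p r : ℝ} (hp : 0 < p) (hr0 : 0 ≤ r)
    (hr1 : r < 1) :
    HasSum (fun n : ℕ => ∫ t in Set.Ioi (0:ℝ), (-1) ^ n * (r * t) ^ (2 * n) / (2 * n).factorial *
        (Real.exp (-p / t) / (Real.exp t - 1)))
      (∫ t in Set.Ioi (0:ℝ), Real.cos (r * t) * (Real.exp (-p / t) / (Real.exp t - 1))) := by
  have hs (t : ℝ) := (Real.hasSum_cosh (r * t)).mul_right (Real.exp (-p / t) / (Real.exp t - 1))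
  refine hasSum_integral_of_dominated_convergence
    (fun n t => (r * t) ^ (2 * n) / (2 * n).factorial * (Real.exp (-p / t) / (Real.exp t - 1)))
    (fun n => Measurable.aestronglyMeasurable (by fun_prop)) (fun n => ?_)
    (.of_forall fun t => (hs t).summable) ?_
    (.of_forall fun t => (Real.hasSum_cos (r * t)).mul_right _)
  · filter_upwards [ae_restrict_mem measurableSet_Ioi] with t ht
    have ht : 0 < t := ht
    have h0 : 0 < Real.exp t - 1 := by linarith [Real.add_one_le_exp t]
    have h1 : 0 ≤ Real.exp (-p / t) / (Real.exp t - 1) := by positivity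
    simp [abs_of_nonneg hr0, abs_of_pos ht, abs_of_pos h0]
  · simp_rw [fun t => (hs t).tsum_eq]
    exact integrableOn_cosh_mul_exp_neg_div_div_exp_sub_one hp hr0 hr1

theorem stmt9 (p r : ℝ) (hp : 0 < p) (hr0 : 0 < r) (hr1 : r < 1) :
    mathieuS 0 p r =
      2 * ∫ x in Set.Ioi (0:ℝ), Real.exp (-p / x) * Real.cos (r * x) / (Real.exp x - 1) := by
  have h := (hasSum_integral_cos_mul_exp_neg_div_div_exp_sub_one hp hr0.le hr1).tsum_eq
  have hcos : ∫ x in Set.Ioi (0:ℝ), Real.exp (-p / x) * Real.cos (r * x) / (Real.exp x - 1) =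
      ∫ x in Set.Ioi (0:ℝ), Real.cos (r * x) * (Real.exp (-p / x) / (Real.exp x - 1)) := by
    congr 1 with x
    ring
  rw [mathieuS, hcos, ← h]
  congr 2 with n
  have hG : Real.Gamma (2 * 0 + 2 * n + 1) = (2 * n).factorial := by
    rw [← Real.Gamma_nat_eq_factorial]
    push_cast
    ring_nf
  have hn : (n.factorial : ℝ) ≠ 0 := by positivity
  rw [zetaP, hG, zero_add, Real.Gamma_nat_eq_factorial, zero_add, Real.Gamma_one, mul_one,
    div_self hn, mul_one, ← integral_const_mul, ← integral_const_mul, ← integral_mul_const]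
  congr 1 with t
  have hpow : t ^ (2 * 0 + 2 * (n : ℝ) + 1 - 1) = t ^ (2 * n) := by
    rw [← Real.rpow_natCast]
    push_cast
    ring_nf
  rw [hpow, mul_pow]
  ring
end

section
/- Let p > 0 and 0 < r < 1. Then S_{1,p}(r) = (1/r) ∫_0^∞ x e^{−p/x} sin(rx) (e^x − 1)^{−1} dx. -/
open Real MeasureTheory

lemma exp_neg_div_mul_div_exp_sub_one_le {p t : ℝ} (hp : 0 < p) (ht : 0 < t) :
    t * Real.exp (-p / t) / (Real.exp t - 1) ≤ (t + 1) * Real.exp (-t) := by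
  have h1 : t + 1 ≤ Real.exp t := Real.add_one_le_exp t
  have hE : Real.exp (-p / t) ≤ 1 :=
    Real.exp_le_one_iff.2 (div_nonpos_of_nonpos_of_nonneg (by linarith) ht.le)
  rw [div_le_iff₀ (by linarith)]
  have h2 : Real.exp (-t) * Real.exp t = 1 := by rw [← Real.exp_add]; simp
  have h3 : (t + 1) * Real.exp (-t) ≤ 1 := by
    nlinarith [mul_le_mul_of_nonneg_right h1 (Real.exp_pos (-t)).le]
  nlinarith [mul_le_mul_of_nonneg_left hE ht.le]

lemma integrableOn_add_one_mul_exp_neg_mul {c : ℝ} (hc : 0 < c) :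
    IntegrableOn (fun t : ℝ => (t + 1) * Real.exp (-c * t)) (Set.Ioi 0) := by
  have h1 := integrableOn_rpow_mul_exp_neg_mul_rpow (s := 1) (p := 1) (b := c)
    (by norm_num) one_pos hc
  have h0 := integrableOn_rpow_mul_exp_neg_mul_rpow (s := 0) (p := 1) (b := c)
    (by norm_num) one_pos hc
  refine (h1.add h0).congr_fun (fun t _ => ?_) measurableSet_Ioi
  simp [add_mul]

lemma integrableOn_mul_sinh_div_exp_sub_one {p r : ℝ} (hp : 0 < p) (hr0 : 0 < r) (hr1 : r < 1) :
    IntegrableOn (fun t : ℝ => t * Real.exp (-p / t) / (Real.exp t - 1) * Real.sinh (r * t))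
      (Set.Ioi 0) := by
  refine Integrable.mono' (integrableOn_add_one_mul_exp_neg_mul (c := 1 - r) (by linarith))
    (by fun_prop) ?_
  refine (ae_restrict_iff' measurableSet_Ioi).2 (.of_forall fun t (ht : 0 < t) => ?_)
  have hrt : 0 ≤ r * t := (mul_pos hr0 ht).le
  have hs : 0 ≤ Real.sinh (r * t) := Real.sinh_nonneg_iff.2 hrt
  have hE : 0 < Real.exp t - 1 := by linarith [Real.add_one_le_exp t]
  have hs' : Real.sinh (r * t) ≤ Real.exp (r * t) := by
    rw [Real.sinh_eq]
    linarith [Real.exp_pos (r * t), Real.exp_pos (-(r * t))]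
  rw [Real.norm_of_nonneg (by positivity)]
  calc _ ≤ (t + 1) * Real.exp (-t) * Real.exp (r * t) := by
        gcongr
        exact exp_neg_div_mul_div_exp_sub_one_le hp ht
    _ = _ := by
        rw [mul_assoc, ← Real.exp_add]
        ring_nf

lemma hasSum_integral_mul_sin_div_exp_sub_one {p r : ℝ}
    (hp : 0 < p) (hr0 : 0 < r) (hr1 : r < 1) :
    HasSum (fun n : ℕ => ∫ t in Set.Ioi (0:ℝ), t * Real.exp (-p / t) / (Real.exp t - 1) *
        ((-1) ^ n * (r * t) ^ (2 * n + 1) / (2 * n + 1).factorial))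
      (∫ t in Set.Ioi (0:ℝ),
        t * Real.exp (-p / t) / (Real.exp t - 1) * Real.sin (r * t)) := by
  refine hasSum_integral_of_dominated_convergence
    (bound := fun n t => t * Real.exp (-p / t) / (Real.exp t - 1) *
      ((r * t) ^ (2 * n + 1) / (2 * n + 1).factorial))
    (fun n => by fun_prop) (fun n => ?_) ?_ ?_ ?_
  · refine (ae_restrict_iff' measurableSet_Ioi).2 (.of_forall fun t (ht : 0 < t) => ?_)
    have hE : 0 < Real.exp t - 1 := by linarith [Real.add_one_le_exp t]
    simp [abs_of_pos, hE, hr0, ht]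
  · exact .of_forall fun t => ((Real.hasSum_sinh (r * t)).mul_left _).summable
  · simp_rw [fun t => ((Real.hasSum_sinh (r * t)).mul_left
      (t * Real.exp (-p / t) / (Real.exp t - 1))).tsum_eq]
    exact integrableOn_mul_sinh_div_exp_sub_one hp hr0 hr1
  · exact .of_forall fun t => (Real.hasSum_sin (r * t)).mul_left _

lemma mathieuS_one_term (p : ℝ) {r : ℝ} (hr : r ≠ 0) (n : ℕ) :
    2 * ((-1 : ℝ) ^ n *
      (Real.Gamma (1 + n + 1) / (n.factorial * Real.Gamma (1 + 1))) *
      zetaP p (2 * 1 + 2 * n + 1) * r ^ (2 * n)) =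
    1 / r * ∫ t in Set.Ioi (0:ℝ), t * Real.exp (-p / t) / (Real.exp t - 1) *
        ((-1) ^ n * (r * t) ^ (2 * n + 1) / (2 * n + 1).factorial) := by
  have hG1 : Real.Gamma (1 + n + 1) = (n + 1).factorial := by
    rw [← Real.Gamma_nat_eq_factorial]; push_cast; ring_nf
  have hG2 : Real.Gamma (1 + 1) = 1 := by
    rw [one_add_one_eq_two, Real.Gamma_two]
  have hG3 : Real.Gamma (2 * 1 + 2 * n + 1) = (2 * n + 1 + 1).factorial := by
    rw [← Real.Gamma_nat_eq_factorial]; push_cast; ring_nf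
  have hI : ∫ t in Set.Ioi (0:ℝ), t * Real.exp (-p / t) / (Real.exp t - 1) *
        ((-1) ^ n * (r * t) ^ (2 * n + 1) / (2 * n + 1).factorial) =
      ((-1) ^ n * r ^ (2 * n + 1) / (2 * n + 1).factorial) *
        ∫ t in Set.Ioi (0:ℝ), t ^ ((2 * 1 + 2 * n + 1 : ℝ) - 1) *
          Real.exp (-p / t) / (Real.exp t - 1) := by
    rw [← integral_const_mul]
    congr 1 with t
    have h : t ^ ((2 * 1 + 2 * n + 1 : ℝ) - 1) = t ^ (2 * n + 2) := by
      rw [← Real.rpow_natCast]; push_cast; ring_nf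
    rw [h]
    ring
  rw [hI, zetaP, hG1, hG2, hG3, Nat.factorial_succ n, Nat.factorial_succ (2 * n + 1)]
  push_cast
  have := Nat.factorial_ne_zero n
  have := Nat.factorial_ne_zero (2 * n + 1)
  field_simp
  ring

theorem stmt10 (p r : ℝ) (hp : 0 < p) (hr0 : 0 < r) (hr1 : r < 1) :
    mathieuS 1 p r =
      (1 / r) * ∫ x in Set.Ioi (0:ℝ),
        x * Real.exp (-p / x) * Real.sin (r * x) / (Real.exp x - 1) := by
  have h := (hasSum_integral_mul_sin_div_exp_sub_one hp hr0 hr1).mul_left (1 / r)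
  rw [mathieuS, ← tsum_mul_left]
  simp_rw [mathieuS_one_term p hr0.ne']
  rw [h.tsum_eq]
  congr 2 with t
  ring
end

section
/- Let p > 0 and 0 < r < 1. Then S_{2,p}(r) = (1/(2r)²) ∫_0^∞ x² e^{−p/x} (sin(rx)/(rx) − cos(rx)) (e^x − 1)^{−1} dx. -/
open Real MeasureTheory

/-- The integrand `t ^ m e ^ (-p / t) / (e ^ t - 1)` is dominated by a Gamma integrand. -/
lemma pow_mul_exp_div_le {p t : ℝ} (hp : 0 < p) (ht : 0 < t) (m : ℕ) :
    t ^ (m + 1) * exp (-p / t) / (exp t - 1) ≤ exp (-t) * t ^ (m + 1) + exp (-t) * t ^ m := by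
  have hexp : t + 1 < exp t := add_one_lt_exp ht.ne'
  have hpos : 0 < exp t - 1 := by linarith
  have hle : exp (-p / t) ≤ 1 := by
    rw [exp_le_one_iff]
    exact div_nonpos_of_nonpos_of_nonneg (by linarith) ht.le
  rw [div_le_iff₀ hpos]
  have hmul : exp (-t) * exp t = 1 := by rw [← exp_add]; simp
  have hkey : t ≤ exp (-t) * (t + 1) * (exp t - 1) := by
    have : exp (-t) * (t + 1) ≤ 1 := by
      calc exp (-t) * (t + 1) ≤ exp (-t) * exp t := by gcongr
        _ = 1 := hmul
    nlinarith
  calc t ^ (m + 1) * exp (-p / t) ≤ t ^ (m + 1) * 1 := by gcongr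
    _ = t ^ m * t := by ring
    _ ≤ t ^ m * (exp (-t) * (t + 1) * (exp t - 1)) := by gcongr
    _ = _ := by ring

lemma pow_mul_exp_div_nonneg {t : ℝ} (ht : 0 < t) (p : ℝ) (m : ℕ) :
    0 ≤ t ^ m * exp (-p / t) / (exp t - 1) := by
  have : 0 < exp t - 1 := by linarith [add_one_lt_exp ht.ne']
  positivity

lemma integrableOn_pow_mul_exp_div {p : ℝ} (hp : 0 < p) (m : ℕ) :
    IntegrableOn (fun t : ℝ => t ^ (m + 1) * exp (-p / t) / (exp t - 1)) (Set.Ioi 0) := by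
  refine Integrable.mono' ((integrableOn_exp_neg_mul_pow (m + 1)).add
    (integrableOn_exp_neg_mul_pow m)) (Measurable.aestronglyMeasurable (by fun_prop)) ?_
  filter_upwards [ae_restrict_mem measurableSet_Ioi] with t ht
  rw [norm_of_nonneg (pow_mul_exp_div_nonneg ht p _)]
  exact pow_mul_exp_div_le hp ht m

lemma integral_pow_mul_exp_div_le {p : ℝ} (hp : 0 < p) (m : ℕ) :
    ∫ t in Set.Ioi (0 : ℝ), t ^ (m + 1) * exp (-p / t) / (exp t - 1) ≤
      2 * (m + 1).factorial := by
  calc _ ≤ ∫ t in Set.Ioi (0 : ℝ), (exp (-t) * t ^ (m + 1) + exp (-t) * t ^ m) :=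
        setIntegral_mono_on (integrableOn_pow_mul_exp_div hp m)
          ((integrableOn_exp_neg_mul_pow (m + 1)).add (integrableOn_exp_neg_mul_pow m))
          measurableSet_Ioi fun t ht => pow_mul_exp_div_le hp ht m
    _ = (m + 1).factorial + m.factorial := by
        rw [integral_add (integrableOn_exp_neg_mul_pow _) (integrableOn_exp_neg_mul_pow _),
          integral_exp_neg_mul_pow, integral_exp_neg_mul_pow]
    _ ≤ _ := by
        have : (m.factorial : ℝ) ≤ (m + 1).factorial :=
          mod_cast Nat.factorial_le m.le_succ
        linarith

/-- The even power series of `sin y / y - cos y`, whose constant term vanishes. -/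
lemma hasSum_sin_div_sub_cos {y : ℝ} (hy : y ≠ 0) :
    HasSum (fun n : ℕ => 4 * ((-1) ^ n * ((n + 1) * (n + 2)) / (2 * n + 4).factorial) *
      y ^ (2 * n + 2)) (sin y / y - cos y) := by
  have h := ((hasSum_sin y).div_const y).sub (hasSum_cos y)
  rw [← hasSum_nat_add_iff' 1] at h
  convert! h using 1
  · funext n
    have e1 : 2 * n + 4 = (2 * n + 3) + 1 := rfl
    have e2 : 2 * (n + 1) + 1 = (2 * n + 2) + 1 := rfl
    have e3 : 2 * (n + 1) = 2 * n + 2 := rfl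
    rw [e1, e2, e3, Nat.factorial_succ (2 * n + 3), Nat.factorial_succ (2 * n + 2)]
    have hf : ((2 * n + 2).factorial : ℝ) ≠ 0 := by positivity
    push_cast
    field_simp
    ring
  · simp [hy]

lemma zetaP_two_mul_add_five (p : ℝ) (n : ℕ) :
    zetaP p (2 * 2 + 2 * n + 1) = 1 / (2 * n + 4).factorial *
      ∫ t in Set.Ioi (0 : ℝ), t ^ (2 * n + 3 + 1) * exp (-p / t) / (exp t - 1) := by
  have h1 : (2 * 2 + 2 * n + 1 : ℝ) = (2 * n + 4 : ℕ) + 1 := by push_cast; ring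
  simp only [zetaP, h1, Gamma_nat_eq_factorial, add_sub_cancel_right, rpow_natCast]

lemma summable_succ_mul_mul_pow {r : ℝ} (hr0 : 0 ≤ r) (hr1 : r < 1) :
    Summable fun n : ℕ => ((n + 1) * (n + 2) : ℝ) * r ^ (2 * n) := by
  have hr : ‖r ^ 2‖ < 1 := by
    rw [norm_of_nonneg (by positivity)]
    exact pow_lt_one₀ hr0 hr1 two_ne_zero
  refine (((summable_pow_mul_geometric_of_norm_lt_one 2 hr).add
    ((summable_pow_mul_geometric_of_norm_lt_one 1 hr).mul_left 3)).add
    ((summable_pow_mul_geometric_of_norm_lt_one 0 hr).mul_left 2)).congr fun n => ?_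
  rw [pow_mul]
  ring

theorem stmt11 (p r : ℝ) (hp : 0 < p) (hr0 : 0 < r) (hr1 : r < 1) :
    mathieuS 2 p r =
      (1 / (2 * r) ^ 2) * ∫ x in Set.Ioi (0:ℝ),
        x ^ 2 * Real.exp (-p / x) * (Real.sin (r * x) / (r * x) - Real.cos (r * x)) /
          (Real.exp x - 1) := by
  set c : ℕ → ℝ := fun n => (-1) ^ n * ((n + 1) * (n + 2)) / (2 * n + 4).factorial * r ^ (2 * n)
    with hc
  set g : ℕ → ℝ → ℝ := fun n t => t ^ (2 * n + 3 + 1) * exp (-p / t) / (exp t - 1) with hg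
  have hcg (n : ℕ) : Integrable (fun t => c n * g n t) (volume.restrict (Set.Ioi 0)) :=
    (integrableOn_pow_mul_exp_div hp (2 * n + 3)).const_mul (c n)
  have hnorm (n : ℕ) : ∫ t in Set.Ioi (0 : ℝ), ‖c n * g n t‖ ≤
      2 * (((n + 1) * (n + 2) : ℝ) * r ^ (2 * n)) := by
    have habs : |c n| = ((n + 1) * (n + 2) : ℝ) / (2 * n + 4).factorial * r ^ (2 * n) := by
      simp only [hc, abs_mul, abs_div, abs_pow, abs_neg, abs_one, one_pow, one_mul,
        abs_of_pos hr0, Nat.abs_cast]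
      rw [abs_of_nonneg (by positivity : (0 : ℝ) ≤ n + 1),
        abs_of_nonneg (by positivity : (0 : ℝ) ≤ n + 2)]
    calc ∫ t in Set.Ioi (0 : ℝ), ‖c n * g n t‖
        = ∫ t in Set.Ioi (0 : ℝ), |c n| * g n t :=
          setIntegral_congr_fun measurableSet_Ioi fun t ht => by
            simp only [norm_mul, norm_eq_abs]
            rw [abs_of_nonneg (pow_mul_exp_div_nonneg ht p _)]
      _ = |c n| * ∫ t in Set.Ioi (0 : ℝ), g n t := integral_const_mul _ _
      _ ≤ |c n| * (2 * (2 * n + 4).factorial) := by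
          gcongr
          exact integral_pow_mul_exp_div_le hp (2 * n + 3)
      _ = _ := by
          have hf : ((2 * n + 4).factorial : ℝ) ≠ 0 := by positivity
          rw [habs]
          field_simp
  have hsum := hasSum_integral_of_summable_integral_norm hcg
    (((summable_succ_mul_mul_pow hr0.le hr1).mul_left 2).of_nonneg_of_le
      (fun n => integral_nonneg fun t => norm_nonneg _) hnorm)
  have hleft : mathieuS 2 p r = ∑' n, ∫ t in Set.Ioi (0 : ℝ), c n * g n t := by
    rw [mathieuS, ← tsum_mul_left]
    congr 1 with n
    have hG : Gamma (2 + n + 1) = (n + 2).factorial := by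
      rw [← Gamma_nat_eq_factorial]
      push_cast
      ring_nf
    have hG2 : Gamma (2 + 1) = 2 := by
      simpa using Gamma_nat_eq_factorial 2
    rw [integral_const_mul, zetaP_two_mul_add_five, hG, hG2, Nat.factorial_succ (n + 1),
      Nat.factorial_succ n]
    have hf : (n.factorial : ℝ) ≠ 0 := by positivity
    simp only [hc, hg]
    push_cast
    field_simp
    ring
  rw [hleft, hsum.tsum_eq, ← integral_const_mul]
  refine setIntegral_congr_fun measurableSet_Ioi fun t (ht : 0 < t) => ?_
  have hs := (hasSum_sin_div_sub_cos (mul_pos hr0 ht).ne').mul_left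
    (1 / (2 * r) ^ 2 * (t ^ 2 * exp (-p / t) / (exp t - 1)))
  calc ∑' n, c n * g n t = _ := by
        refine Eq.trans (tsum_congr fun n => ?_) hs.tsum_eq
        simp only [hc, hg]
        field_simp
        ring
    _ = _ := by ring
end
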